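/- arXiv:1611.01655 — 2 statements merged into one kernel-verified Lean document; each statement's English description precedes it below -/
import Mathlib

section
/- For every real r ∈ (0,1) and every integer n > 1/r, the quantity u_Opt(n,r) satisfies (1/n)·(r·n)^{1/(4r)} ≤ u_Opt(n,r) ≤ n²·(3·r·n)^{16/r}. -/
namespace TQ

/-- A decision tree: internal nodes are labeled by questions (subsets of `α`,
with the two children corresponding to Yes/No), leaves by elements of `α`. -/
inductive DTree (α : Type) where
  | leaf (x : α) : DTree α
  | node (q : Finset α) (yes no : DTree α) : DTree α

namespace DTree

variable {α : Type} [DecidableEq α]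

/-- The list of leaf labels of a decision tree. -/
def leaves : DTree α → List α
  | .leaf x => [x]
  | .node _ t f => leaves t ++ leaves f

/-- The set of questions appearing at internal nodes. -/
def questions : DTree α → Set (Finset α)
  | .leaf _ => ∅
  | .node q t f => insert q (questions t ∪ questions f)

/-- Follow the path of `x` (Yes-edge iff `x` belongs to the question);
returns `some d` iff the path ends at a leaf labeled `x`, at depth `d`. -/
def find? : DTree α → α → Option ℕ
  | .leaf y, x => if y = x then some 0 else none
  | .node q t f, x => (if x ∈ q then find? t x else find? f x).map (· + 1)

/-- The depth of the leaf labeled `x` (junk value `0` if the path of `x`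
does not end at a leaf labeled `x`). -/
def depth (T : DTree α) (x : α) : ℕ := (T.find? x).getD 0

end DTree

variable {α : Type} [Fintype α] [DecidableEq α]

/-- `μ` is a probability distribution on `α`. -/
def IsDistribution (μ : α → ℝ) : Prop := (∀ x, 0 ≤ μ x) ∧ ∑ x, μ x = 1

/-- `T` is valid for `μ`: its leaves are distinct, the set of leaf labels is the
support of `μ`, and for every `x` in the support the path of `x` ends at the
leaf labeled `x`. -/
structure IsValid (T : DTree α) (μ : α → ℝ) : Prop where
  nodup : T.leaves.Nodup
  mem_leaves : ∀ x, x ∈ T.leaves ↔ μ x ≠ 0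
  finds : ∀ x, μ x ≠ 0 → T.find? x = some (T.depth x)

/-- The cost of `T` on `μ`: the average depth `∑ x, μ(x) · T(x)`. -/
noncomputable def cost (T : DTree α) (μ : α → ℝ) : ℝ := ∑ x, μ x * (T.depth x : ℝ)

/-- All questions of `T` belong to `Q`. -/
def UsesQuestions (T : DTree α) (Q : Set (Finset α)) : Prop := T.questions ⊆ Q

/-- `Opt(μ)`: the optimal cost over all decision trees valid for `μ`. -/
noncomputable def OptCost (μ : α → ℝ) : ℝ :=
  sInf { c | ∃ T : DTree α, IsValid T μ ∧ c = cost T μ }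

/-- `c_Q(μ)`: the optimal cost over decision trees valid for `μ`
using only questions from `Q`. -/
noncomputable def cQ (Q : Set (Finset α)) (μ : α → ℝ) : ℝ :=
  sInf { c | ∃ T : DTree α, IsValid T μ ∧ UsesQuestions T Q ∧ c = cost T μ }

/-- The base-2 (Shannon) entropy of `μ`. (Note `Real.logb 2 0 = 0`.) -/
noncomputable def entropy (μ : α → ℝ) : ℝ := ∑ x, -(μ x * Real.logb 2 (μ x))

/-- `Q` achieves prolixity `r`: for every distribution there is a valid tree using
only questions from `Q` of cost at most `Opt(μ) + r`. -/
def AchievesProlixity {n : ℕ} (Q : Finset (Finset (Fin n))) (r : ℝ) : Prop :=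
  ∀ μ : Fin n → ℝ, IsDistribution μ →
    ∃ T : DTree (Fin n), IsValid T μ ∧ UsesQuestions T ↑Q ∧ cost T μ ≤ OptCost μ + r

/-- `Q` achieves redundancy `r`: for every distribution there is a valid tree using
only questions from `Q` of cost at most `H(μ) + r`. -/
def AchievesRedundancy {n : ℕ} (Q : Finset (Finset (Fin n))) (r : ℝ) : Prop :=
  ∀ μ : Fin n → ℝ, IsDistribution μ →
    ∃ T : DTree (Fin n), IsValid T μ ∧ UsesQuestions T ↑Q ∧ cost T μ ≤ entropy μ + r

/-- `u_Opt(n,r)`: the minimum cardinality of a set of questions achieving prolixity `r`. -/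
noncomputable def uOpt (n : ℕ) (r : ℝ) : ℕ :=
  sInf { k | ∃ Q : Finset (Finset (Fin n)), Q.card = k ∧ AchievesProlixity Q r }

/-- `u_H(n,r)`: the minimum cardinality of a set of questions achieving redundancy `r`. -/
noncomputable def uH (n : ℕ) (r : ℝ) : ℕ :=
  sInf { k | ∃ Q : Finset (Finset (Fin n)), Q.card = k ∧ AchievesRedundancy Q r }

end TQ

namespace TQ

section Basics

variable {α : Type} [DecidableEq α]

/-- The tree `T` identifies exactly the elements of `C`. -/
def Good (C : Finset α) (T : DTree α) : Prop :=
  T.leaves.Nodup ∧ (∀ x, x ∈ T.leaves ↔ x ∈ C) ∧ ∀ x ∈ C, T.find? x = some (T.depth x)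

lemma depth_node_mem {q : Finset α} {t f : DTree α} {x : α} (hx : x ∈ q)
    (h : (t.find? x).isSome) : (DTree.node q t f).depth x = t.depth x + 1 := by
  obtain ⟨d, hd⟩ := Option.isSome_iff_exists.1 h
  simp [DTree.depth, DTree.find?, hx, hd]

lemma depth_node_not_mem {q : Finset α} {t f : DTree α} {x : α} (hx : x ∉ q)
    (h : (f.find? x).isSome) : (DTree.node q t f).depth x = f.depth x + 1 := by
  obtain ⟨d, hd⟩ := Option.isSome_iff_exists.1 h
  simp [DTree.depth, DTree.find?, hx, hd]

lemma isSome_node_mem {q : Finset α} {t f : DTree α} {x : α} (hx : x ∈ q)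
    (h : ((DTree.node q t f).find? x).isSome) : (t.find? x).isSome := by
  simpa [DTree.find?, hx] using h

lemma isSome_node_not_mem {q : Finset α} {t f : DTree α} {x : α} (hx : x ∉ q)
    (h : ((DTree.node q t f).find? x).isSome) : (f.find? x).isSome := by
  simpa [DTree.find?, hx] using h

lemma kraft (T : DTree α) : ∀ P : Finset α, (∀ x ∈ P, (T.find? x).isSome) →
    ∑ x ∈ P, (1 / 2 : ℝ) ^ (T.depth x) ≤ 1 := by
  induction T with
  | leaf y =>
    intro P hP
    have hsub : P ⊆ {y} := by
      intro x hx
      have := hP x hx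
      simp only [DTree.find?] at this
      split_ifs at this with h
      · simp [h]
      · simp at this
    calc ∑ x ∈ P, (1 / 2 : ℝ) ^ ((DTree.leaf y).depth x)
        ≤ ∑ x ∈ {y}, (1 / 2 : ℝ) ^ ((DTree.leaf y).depth x) :=
          Finset.sum_le_sum_of_subset_of_nonneg hsub (fun _ _ _ => by positivity)
      _ = 1 := by simp [DTree.depth, DTree.find?]
  | node q t f iht ihf =>
    intro P hP
    rw [← Finset.sum_filter_add_sum_filter_not P (· ∈ q)]
    have h1 := iht (P.filter (· ∈ q)) (fun x hx => by
      rw [Finset.mem_filter] at hx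
      exact isSome_node_mem hx.2 (hP x hx.1))
    have h2 := ihf (P.filter (· ∉ q)) (fun x hx => by
      rw [Finset.mem_filter] at hx
      exact isSome_node_not_mem hx.2 (hP x hx.1))
    have e1 : ∑ x ∈ P.filter (· ∈ q), (1 / 2 : ℝ) ^ ((DTree.node q t f).depth x)
        = (1 / 2) * ∑ x ∈ P.filter (· ∈ q), (1 / 2 : ℝ) ^ (t.depth x) := by
      rw [Finset.mul_sum]
      refine Finset.sum_congr rfl fun x hx => ?_
      rw [Finset.mem_filter] at hx
      rw [depth_node_mem hx.2 (isSome_node_mem hx.2 (hP x hx.1)), pow_succ]; ring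
    have e2 : ∑ x ∈ P.filter (· ∉ q), (1 / 2 : ℝ) ^ ((DTree.node q t f).depth x)
        = (1 / 2) * ∑ x ∈ P.filter (· ∉ q), (1 / 2 : ℝ) ^ (f.depth x) := by
      rw [Finset.mul_sum]
      refine Finset.sum_congr rfl fun x hx => ?_
      rw [Finset.mem_filter] at hx
      rw [depth_node_not_mem hx.2 (isSome_node_not_mem hx.2 (hP x hx.1)), pow_succ]; ring
    rw [e1, e2]
    linarith

lemma good_node {A B q : Finset α} {t f : DTree α} (hA : Good A t) (hB : Good B f)
    (hd : Disjoint A B) (hAq : A ⊆ q) (hBq : Disjoint B q) :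
    Good (A ∪ B) (DTree.node q t f) := by
  obtain ⟨a1, a2, a3⟩ := hA
  obtain ⟨b1, b2, b3⟩ := hB
  refine ⟨?_, ?_, ?_⟩
  · simp only [DTree.leaves]
    rw [List.nodup_append']
    refine ⟨a1, b1, ?_⟩
    intro x hx hx'
    exact Finset.disjoint_left.1 hd ((a2 x).1 hx) ((b2 x).1 hx')
  · intro x
    simp [DTree.leaves, a2, b2]
  · intro x hx
    rw [Finset.mem_union] at hx
    rcases hx with hx | hx
    · have := a3 x hx
      rw [depth_node_mem (hAq hx) (by simp [this])]
      simp [DTree.find?, hAq hx, this]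
    · have := b3 x hx
      have hq := Finset.disjoint_left.1 hBq hx
      rw [depth_node_not_mem hq (by simp [this])]
      simp [DTree.find?, hq, this]

lemma exists_subset_sum (e : α → ℕ) (m : ℕ) : ∀ S : Finset α, (∀ x ∈ S, e x ≤ m) →
    2 ^ m ≤ ∑ x ∈ S, 2 ^ e x → ∃ S' ⊆ S, ∑ x ∈ S', 2 ^ e x = 2 ^ m := by
  intro S
  induction S using Finset.strongInduction with
  | H S ih =>
    intro hle hsum
    have hne : S.Nonempty := by
      rw [Finset.nonempty_iff_ne_empty]
      rintro rfl
      simp at hsum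
    obtain ⟨x, hxS, hx⟩ := Finset.exists_min_image S e hne
    by_cases h : 2 ^ m ≤ ∑ y ∈ S.erase x, 2 ^ e y
    · obtain ⟨S', h1, h2⟩ := ih (S.erase x) (Finset.erase_ssubset hxS)
        (fun y hy => hle y (Finset.mem_of_mem_erase hy)) h
      exact ⟨S', h1.trans (Finset.erase_subset _ _), h2⟩
    · refine ⟨S, subset_rfl, ?_⟩
      push Not at h
      have d1 : 2 ^ e x ∣ ∑ y ∈ S.erase x, 2 ^ e y :=
        Finset.dvd_sum fun y hy => pow_dvd_pow 2 (hx y (Finset.mem_of_mem_erase hy))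
      have d2 : 2 ^ e x ∣ 2 ^ m := pow_dvd_pow 2 (hle x hxS)
      have h3 := Finset.sum_erase_add S (fun y => 2 ^ e y) hxS
      obtain ⟨u, hu⟩ := d1
      obtain ⟨v, hv⟩ := d2
      have huv : u < v := by
        rw [hu, hv] at h
        exact Nat.lt_of_mul_lt_mul_left h
      have : 2 ^ e x * (u + 1) ≤ 2 ^ e x * v := Nat.mul_le_mul_left _ huv
      rw [mul_add, ← hu, ← hv] at this
      omega

end Basics

/-- potential function -/
noncomputable def G (r : ℝ) (d : ℕ) : ℝ := d + max 0 (3 * r / 4 - 6 * (1 / 2 : ℝ) ^ d)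

lemma G_nonneg (r : ℝ) (d : ℕ) : 0 ≤ G r d := by
  unfold G; positivity

lemma G_succ (r : ℝ) (d : ℕ) : 1 + G r d ≤ G r (d + 1) := by
  unfold G
  have : max 0 (3 * r / 4 - 6 * (1 / 2 : ℝ) ^ d) ≤ max 0 (3 * r / 4 - 6 * (1 / 2 : ℝ) ^ (d + 1)) := by
    apply max_le_max le_rfl
    have : (0 : ℝ) < (1 / 2) ^ d := by positivity
    rw [pow_succ]; linarith
  push_cast
  linarith

lemma G_light (r : ℝ) (hr : r < 1) (d : ℕ) (h : (1 / 2 : ℝ) ^ (d + 1) < r / 16) :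
    1 ≤ (1 - 4 * (1 / 2 : ℝ) ^ (d + 1)) * (G r (d + 1) - G r d) := by
  have h0 : (0 : ℝ) < (1 / 2) ^ (d + 1) := by positivity
  have h1 : (1 / 2 : ℝ) ^ d = 2 * (1 / 2) ^ (d + 1) := by rw [pow_succ]; ring
  unfold G
  rw [h1]
  set t := (1 / 2 : ℝ) ^ (d + 1)
  rw [max_eq_right (by linarith), max_eq_right (by linarith)]
  push_cast
  nlinarith

lemma G_le (r : ℝ) (hr : 0 < r) (d : ℕ) : G r d ≤ d + 3 * r / 4 := by
  unfold G
  have h0 : (0 : ℝ) < (1 / 2) ^ d := by positivity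
  have : max 0 (3 * r / 4 - 6 * (1 / 2 : ℝ) ^ d) ≤ 3 * r / 4 := max_le (by positivity) (by linarith)
  linarith

/-- The question family: unions of an interval and a set of at most `16 / r` elements. -/
def QS (n : ℕ) (r : ℝ) : Set (Finset (Fin n)) :=
  {q | ∃ i k : Fin n, ∃ S : Finset (Fin n), (S.card : ℝ) ≤ 16 / r ∧ q = Finset.Icc i k ∪ S}

/-- The conclusion of the recursive construction. -/
def Built {n : ℕ} (r : ℝ) (μ : Fin n → ℝ) (j : ℕ) (C : Finset (Fin n)) (e : Fin n → ℕ) : Prop :=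
  ∃ T : DTree (Fin n), Good C T ∧ T.questions ⊆ QS n r ∧
    ∑ x ∈ C, μ x * (T.depth x : ℝ) ≤ ∑ x ∈ C, μ x * G r (j - e x)

lemma built_step {n : ℕ} {r : ℝ} {μ : Fin n → ℝ} (hμ : ∀ x, 0 ≤ μ x) {j : ℕ}
    (ih : ∀ C : Finset (Fin n), C.Nonempty → ∀ e : Fin n → ℕ, ∑ x ∈ C, 2 ^ e x ≤ 2 ^ j →
      Built r μ j C e)
    {C A B q : Finset (Fin n)} (hC : C.Nonempty) (e e' : Fin n → ℕ) (hAB : A ∪ B = C)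
    (hd : Disjoint A B) (hAq : A ⊆ q) (hBq : Disjoint B q) (hq : q ∈ QS n r)
    (hA : ∑ x ∈ A, 2 ^ e' x ≤ 2 ^ j) (hB : ∑ x ∈ B, 2 ^ e' x ≤ 2 ^ j)
    (hcost : ∑ x ∈ C, μ x * (1 + G r (j - e' x)) ≤ ∑ x ∈ C, μ x * G r (j + 1 - e x)) :
    Built r μ (j + 1) C e := by
  have hmono : ∑ x ∈ C, μ x * G r (j - e' x) ≤ ∑ x ∈ C, μ x * (1 + G r (j - e' x)) :=
    Finset.sum_le_sum fun x _ => mul_le_mul_of_nonneg_left (by linarith) (hμ x)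
  rcases A.eq_empty_or_nonempty with rfl | hAne
  · rw [Finset.empty_union] at hAB
    subst hAB
    obtain ⟨T, h1, h2, h3⟩ := ih B hC e' hB
    exact ⟨T, h1, h2, h3.trans (hmono.trans hcost)⟩
  rcases B.eq_empty_or_nonempty with rfl | hBne
  · rw [Finset.union_empty] at hAB
    subst hAB
    obtain ⟨T, h1, h2, h3⟩ := ih A hC e' hA
    exact ⟨T, h1, h2, h3.trans (hmono.trans hcost)⟩
  obtain ⟨t, t1, t2, t3⟩ := ih A hAne e' hA
  obtain ⟨f, f1, f2, f3⟩ := ih B hBne e' hB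
  refine ⟨DTree.node q t f, hAB ▸ good_node t1 f1 hd hAq hBq, ?_, ?_⟩
  · simp only [DTree.questions]
    exact Set.insert_subset hq (Set.union_subset t2 f2)
  · refine le_trans ?_ hcost
    rw [← hAB, Finset.sum_union hd, Finset.sum_union hd]
    have e1 : ∑ x ∈ A, μ x * ((DTree.node q t f).depth x : ℝ)
        = ∑ x ∈ A, μ x + ∑ x ∈ A, μ x * (t.depth x : ℝ) := by
      rw [← Finset.sum_add_distrib]
      refine Finset.sum_congr rfl fun x hx => ?_
      rw [depth_node_mem (hAq hx) (by simp [t1.2.2 x hx])]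
      push_cast; ring
    have e2 : ∑ x ∈ B, μ x * ((DTree.node q t f).depth x : ℝ)
        = ∑ x ∈ B, μ x + ∑ x ∈ B, μ x * (f.depth x : ℝ) := by
      rw [← Finset.sum_add_distrib]
      refine Finset.sum_congr rfl fun x hx => ?_
      rw [depth_node_not_mem (Finset.disjoint_left.1 hBq hx) (by simp [f1.2.2 x hx])]
      push_cast; ring
    rw [e1, e2]
    simp only [mul_add, mul_one, Finset.sum_add_distrib]
    linarith

/-- Overlap of the block `[p, p+τ)` with the arc `[θ, θ+a)`. -/
def cnt (p τ θ a : ℕ) : ℕ := min (p + τ) (θ + a) - max p θ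

lemma cnt_eq (p τ θ a : ℕ) :
    (Finset.Ico p (p + τ) ∩ Finset.Ico θ (θ + a)).card = cnt p τ θ a := by
  rw [Finset.Ico_inter_Ico, Nat.card_Ico]
  simp [cnt]

lemma cnt_le (p τ θ a : ℕ) : cnt p τ θ a ≤ τ := by
  unfold cnt; omega

lemma cnt_sdiff (p τ θ a : ℕ) :
    (Finset.Ico p (p + τ) \ Finset.Ico θ (θ + a)).card = τ - cnt p τ θ a := by
  have := Finset.card_sdiff_add_card_inter (Finset.Ico p (p + τ)) (Finset.Ico θ (θ + a))
  rw [cnt_eq, Nat.card_Ico] at this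
  omega

lemma cut_card (p τ a M : ℕ) :
    ((Finset.range M).filter (fun θ => 0 < cnt p τ θ a ∧ cnt p τ θ a < τ)).card ≤ 2 * τ := by
  have hsub : (Finset.range M).filter (fun θ => 0 < cnt p τ θ a ∧ cnt p τ θ a < τ)
      ⊆ Finset.Ico p (p + τ) ∪ Finset.Ico (p - a) (p + τ - a) := by
    intro θ hθ
    rw [Finset.mem_filter] at hθ
    obtain ⟨_, h1, h2⟩ := hθ
    unfold cnt at h1 h2
    rw [Finset.mem_union, Finset.mem_Ico, Finset.mem_Ico]
    omega
  refine (Finset.card_le_card hsub).trans ((Finset.card_union_le _ _).trans ?_)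
  simp only [Nat.card_Ico]
  omega

section Blocks
variable {n : ℕ} (L : Finset (Fin n)) (e : Fin n → ℕ)

/-- Start position of the block of `y`. -/
def pos (y : Fin n) : ℕ := ∑ x ∈ L.filter (· < y), 2 ^ e x

lemma pos_add_le {y z : Fin n} (hy : y ∈ L) (hyz : y < z) : pos L e y + 2 ^ e y ≤ pos L e z := by
  unfold pos
  have hn : y ∉ L.filter (· < y) := by simp
  rw [add_comm, ← Finset.sum_insert (f := fun x => 2 ^ e x) hn]
  apply Finset.sum_le_sum_of_subset
  intro x hx
  simp only [Finset.mem_insert, Finset.mem_filter] at hx ⊢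
  rcases hx with rfl | hx
  · exact ⟨hy, hyz⟩
  · exact ⟨hx.1, hx.2.trans hyz⟩

lemma pos_add_le_sum {y : Fin n} (hy : y ∈ L) : pos L e y + 2 ^ e y ≤ ∑ x ∈ L, 2 ^ e x := by
  unfold pos
  have hn : y ∉ L.filter (· < y) := by simp
  rw [add_comm, ← Finset.sum_insert (f := fun x => 2 ^ e x) hn]
  apply Finset.sum_le_sum_of_subset
  intro x hx
  simp only [Finset.mem_insert, Finset.mem_filter] at hx
  rcases hx with rfl | hx
  · exact hy
  · exact hx.1

lemma blocks_disjoint {y z : Fin n} (hy : y ∈ L) (hz : z ∈ L) (h : y ≠ z) :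
    Disjoint (Finset.Ico (pos L e y) (pos L e y + 2 ^ e y))
      (Finset.Ico (pos L e z) (pos L e z + 2 ^ e z)) := by
  rw [Finset.disjoint_left]
  intro u hu hu'
  rw [Finset.mem_Ico] at hu hu'
  rcases lt_or_gt_of_ne h with h | h
  · have := pos_add_le L e hy h; omega
  · have := pos_add_le L e hz h; omega

lemma sum_cnt_le {A : Finset (Fin n)} (hA : A ⊆ L) (θ a : ℕ) :
    ∑ y ∈ A, cnt (pos L e y) (2 ^ e y) θ a ≤ a := by
  simp_rw [← cnt_eq]
  rw [← Finset.card_biUnion]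
  · calc _ ≤ (Finset.Ico θ (θ + a)).card := by
          apply Finset.card_le_card
          intro u hu
          rw [Finset.mem_biUnion] at hu
          obtain ⟨y, _, hu⟩ := hu
          exact Finset.mem_of_mem_inter_right hu
      _ = a := by simp
  · intro y hy z hz hyz
    exact (blocks_disjoint L e (hA hy) (hA hz) hyz).mono Finset.inter_subset_left
      Finset.inter_subset_left

lemma sum_sub_cnt_le {B : Finset (Fin n)} (hB : B ⊆ L) (θ a M : ℕ) (hθ : θ ≤ M)
    (hL : ∑ x ∈ L, 2 ^ e x ≤ M + a) :
    ∑ y ∈ B, (2 ^ e y - cnt (pos L e y) (2 ^ e y) θ a) ≤ M := by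
  simp_rw [← cnt_sdiff]
  rw [← Finset.card_biUnion]
  · calc _ ≤ (Finset.range θ ∪ Finset.Ico (θ + a) (∑ x ∈ L, 2 ^ e x)).card := by
          apply Finset.card_le_card
          intro u hu
          rw [Finset.mem_biUnion] at hu
          obtain ⟨y, hy, hu⟩ := hu
          have := pos_add_le_sum L e (hB hy)
          simp only [Finset.mem_sdiff, Finset.mem_Ico, Finset.mem_union, Finset.mem_range] at hu ⊢
          omega
      _ ≤ _ := Finset.card_union_le _ _
      _ ≤ M := by
          simp only [Nat.card_Ico, Finset.card_range]; omega
  · intro y hy z hz hyz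
    exact (blocks_disjoint L e (hB hy) (hB hz) hyz).mono Finset.sdiff_subset
      Finset.sdiff_subset

end Blocks

lemma build {n : ℕ} {r : ℝ} (hr0 : 0 < r) (hr1 : r < 1) {μ : Fin n → ℝ} (hμ : ∀ x, 0 ≤ μ x) :
    ∀ j : ℕ, ∀ C : Finset (Fin n), C.Nonempty → ∀ e : Fin n → ℕ, ∑ x ∈ C, 2 ^ e x ≤ 2 ^ j →
      Built r μ j C e := by
  intro j
  have single : ∀ (j : ℕ) (x : Fin n) (e : Fin n → ℕ), Built r μ j {x} e := by
    intro j x e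
    refine ⟨DTree.leaf x, ⟨by simp [DTree.leaves], by simp [DTree.leaves], ?_⟩, ?_, ?_⟩
    · intro y hy
      rw [Finset.mem_singleton] at hy
      subst hy
      simp [DTree.find?, DTree.depth]
    · simp [DTree.questions]
    · simp only [Finset.sum_singleton, DTree.depth, DTree.find?]
      simp [mul_nonneg (hμ x) (G_nonneg r _)]
  induction j with
  | zero =>
    intro C hC e hsum
    have hcard : C.card ≤ 1 := by
      calc C.card = ∑ x ∈ C, 1 := by simp
        _ ≤ ∑ x ∈ C, 2 ^ e x := Finset.sum_le_sum fun x _ => Nat.one_le_two_pow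
        _ ≤ 1 := by simpa using hsum
    obtain ⟨x, rfl⟩ := Finset.card_eq_one.1 (le_antisymm hcard hC.card_pos)
    exact single 0 x e
  | succ j ih =>
    intro C hC e hsum
    by_cases hcard : C.card ≤ 1
    · obtain ⟨x, rfl⟩ := Finset.card_eq_one.1 (le_antisymm hcard hC.card_pos)
      exact single _ x e
    push Not at hcard
    -- an empty interval
    obtain ⟨i₀, k₀, hempty⟩ : ∃ i k : Fin n, Finset.Icc i k = ∅ := by
      obtain ⟨x, _, y, _, hxy⟩ := Finset.one_lt_card.1 hcard
      rcases lt_or_gt_of_ne hxy with h | h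
      · exact ⟨y, x, Finset.Icc_eq_empty (not_le.2 h)⟩
      · exact ⟨x, y, Finset.Icc_eq_empty (not_le.2 h)⟩
    have hej : ∀ x ∈ C, e x ≤ j := by
      intro x hx
      obtain ⟨y, hy, hyx⟩ := Finset.exists_mem_ne hcard x
      have h1 : ∑ z ∈ ({x, y} : Finset (Fin n)), 2 ^ e z ≤ ∑ z ∈ C, 2 ^ e z := by
        apply Finset.sum_le_sum_of_subset
        intro z hz
        simp only [Finset.mem_insert, Finset.mem_singleton] at hz
        rcases hz with rfl | rfl <;> assumption
      rw [Finset.sum_pair (Ne.symm hyx)] at h1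
      have h2 : 0 < 2 ^ e y := by positivity
      have h3 : 2 ^ e x < 2 ^ (j + 1) := by omega
      have := (Nat.pow_lt_pow_iff_right (by norm_num : 1 < 2)).1 h3
      omega
    have hsucc : ∀ x ∈ C, j + 1 - e x = (j - e x) + 1 := fun x hx => by
      have := hej x hx; omega
    have hratio : ∀ x ∈ C, (1 / 2 : ℝ) ^ (j - e x + 1) * 2 ^ (j + 1) = 2 ^ e x := by
      intro x hx
      have h1 : j + 1 = (j - e x + 1) + e x := by have := hej x hx; omega
      conv_lhs => rw [h1, pow_add 2]
      have h2 : j - e x + 1 + e x - e x = j - e x + 1 := by omega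
      rw [show j - e x + 1 = j - e x + 1 from rfl, ← mul_assoc, ← mul_pow]
      norm_num
    classical
    set H := C.filter (fun x => r / 16 ≤ (1 / 2 : ℝ) ^ (j - e x + 1)) with hH
    set L := C.filter (fun x => ¬ (r / 16 ≤ (1 / 2 : ℝ) ^ (j - e x + 1))) with hL
    have hHC : H ⊆ C := Finset.filter_subset _ _
    have hLC : L ⊆ C := Finset.filter_subset _ _
    have hHL : H ∪ L = C := Finset.filter_union_filter_not_eq _ _
    have hHLd : Disjoint H L := Finset.disjoint_filter_filter_not _ _ _
    have hHcard : (H.card : ℝ) ≤ 16 / r := by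
      have h1 : ∑ x ∈ H, (2 : ℝ) ^ e x ≤ 2 ^ (j + 1) := by
        have : ∑ x ∈ H, 2 ^ e x ≤ 2 ^ (j + 1) :=
          (Finset.sum_le_sum_of_subset hHC).trans hsum
        exact_mod_cast this
      have h2 : ∑ x ∈ H, (r / 16) * 2 ^ (j + 1) ≤ ∑ x ∈ H, (2 : ℝ) ^ e x := by
        refine Finset.sum_le_sum fun x hx => ?_
        rw [← hratio x (hHC hx)]
        exact mul_le_mul_of_nonneg_right (Finset.mem_filter.1 hx).2 (by positivity)
      rw [Finset.sum_const, nsmul_eq_mul] at h2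
      have h3 : (0 : ℝ) < 2 ^ (j + 1) := by positivity
      have h4 : (H.card : ℝ) * (r / 16) ≤ 1 := by
        by_contra h
        push Not at h
        nlinarith
      rw [le_div_iff₀ hr0]
      linarith
    by_cases hbig : 2 ^ j ≤ ∑ x ∈ H, 2 ^ e x
    · -- heavy elements suffice
      obtain ⟨A, hAH, hAsum⟩ := exists_subset_sum e j H (fun x hx => hej x (hHC hx)) hbig
      have hAC := hAH.trans hHC
      refine built_step hμ ih hC e e (A := A) (B := C \ A) (q := A)
        (Finset.union_sdiff_of_subset hAC) Finset.disjoint_sdiff subset_rfl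
        Finset.sdiff_disjoint ?_ hAsum.le ?_ ?_
      · refine ⟨i₀, k₀, A, ?_, by simp [hempty]⟩
        exact le_trans (by exact_mod_cast Finset.card_le_card hAH) hHcard
      · have := Finset.sum_sdiff (f := fun x => 2 ^ e x) hAC
        rw [pow_succ] at hsum
        omega
      · refine Finset.sum_le_sum fun x hx => mul_le_mul_of_nonneg_left ?_ (hμ x)
        rw [hsucc x hx]
        exact G_succ r _
    push Not at hbig
    obtain ⟨a, ha⟩ : ∃ a, ∑ x ∈ H, 2 ^ e x + a = 2 ^ j := ⟨_, Nat.add_sub_of_le hbig.le⟩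
    have hsplit : ∑ x ∈ H, 2 ^ e x + ∑ x ∈ L, 2 ^ e x = ∑ x ∈ C, 2 ^ e x := by
      rw [← hHL, Finset.sum_union hHLd]
    have hLsum : ∑ x ∈ L, 2 ^ e x ≤ 2 ^ j + a := by
      rw [pow_succ] at hsum
      omega
    let c : ℕ → Fin n → ℕ := fun θ y => cnt (pos L e y) (2 ^ e y) θ a
    let cut : ℕ → Fin n → Prop := fun θ y => 0 < c θ y ∧ c θ y < 2 ^ e y
    let D : Fin n → ℝ := fun y => G r (j - e y + 1) - G r (j - e y)
    -- averaging
    obtain ⟨θ, hθ, hav⟩ : ∃ θ ∈ Finset.range (2 ^ j),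
        ∑ y ∈ L, (if cut θ y then μ y * D y else 0) ≤ ∑ y ∈ L, μ y * (D y - 1) := by
      apply Finset.exists_le_of_sum_le (by simp)
      rw [Finset.sum_comm, Finset.sum_const, Finset.card_range, nsmul_eq_mul, Finset.mul_sum]
      refine Finset.sum_le_sum fun y hy => ?_
      rw [← Finset.sum_filter, Finset.sum_const, nsmul_eq_mul]
      have hc : (((Finset.range (2 ^ j)).filter (fun θ => cut θ y)).card : ℝ) ≤ 2 * 2 ^ e y := by
        exact_mod_cast cut_card (pos L e y) (2 ^ e y) a (2 ^ j)
      have hl := (Finset.mem_filter.1 hy).2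
      push Not at hl
      have hG := G_light r hr1 _ hl
      have hGs := G_succ r (j - e y)
      have hDy : 1 ≤ D y := by simp only [D]; linarith
      have hrat := hratio y (hLC hy)
      have h1 : (2 : ℝ) * 2 ^ e y * D y ≤ 2 ^ j * (D y - 1) := by
        rw [← hrat, pow_succ 2 j]
        have h2 : (0 : ℝ) < 2 ^ j := by positivity
        have h3 : 1 ≤ (1 - 4 * (1 / 2 : ℝ) ^ (j - e y + 1)) * D y := hG
        nlinarith
      calc _ ≤ 2 * 2 ^ e y * (μ y * D y) := by
            apply mul_le_mul_of_nonneg_right hc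
            exact mul_nonneg (hμ y) (by linarith)
        _ = μ y * (2 * 2 ^ e y * D y) := by ring
        _ ≤ μ y * (2 ^ j * (D y - 1)) := mul_le_mul_of_nonneg_left h1 (hμ y)
        _ = _ := by push_cast; ring
    rw [Finset.mem_range] at hθ
    let e' : Fin n → ℕ := fun y => if y ∈ L ∧ cut θ y then e y - 1 else e y
    set AL := L.filter (fun y => 2 ^ e y ≤ 2 * c θ y) with hAL
    set BL := L.filter (fun y => ¬ (2 ^ e y ≤ 2 * c θ y)) with hBL
    have hALL : AL ⊆ L := Finset.filter_subset _ _
    have hBLL : BL ⊆ L := Finset.filter_subset _ _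
    have hALBL : AL ∪ BL = L := Finset.filter_union_filter_not_eq _ _
    have hALBLd : Disjoint AL BL := Finset.disjoint_filter_filter_not _ _ _
    have hcle : ∀ y, c θ y ≤ 2 ^ e y := fun y => cnt_le _ _ _ _
    have hpow : ∀ y, 2 ^ e y = 1 ∨ 2 ^ e y = 2 * 2 ^ (e y - 1) := by
      intro y
      rcases Nat.eq_zero_or_pos (e y) with h | h
      · left; simp [h]
      · right
        rw [← pow_succ', Nat.sub_add_cancel h]
    have hcutpos : ∀ y, cut θ y → 2 ^ e y = 2 * 2 ^ (e y - 1) ∧ 1 ≤ e y := by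
      intro y hy
      obtain ⟨h1, h2⟩ := hy
      refine ⟨?_, ?_⟩
      · rcases hpow y with h | h
        · omega
        · exact h
      · by_contra h
        have : e y = 0 := by omega
        rw [this] at h2
        simp at h2
        omega
    obtain ⟨i, k, hIcc, hALI⟩ : ∃ i k : Fin n, (∀ y ∈ BL, y ∉ Finset.Icc i k) ∧
        AL ⊆ Finset.Icc i k := by
      rcases AL.eq_empty_or_nonempty with h0 | hne
      · exact ⟨i₀, k₀, by simp [hempty], by simp [h0]⟩
      · refine ⟨AL.min' hne, AL.max' hne, ?_, ?_⟩
        · intro y hy hyI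
          rw [Finset.mem_Icc] at hyI
          have hm := AL.min'_mem hne
          have hM := AL.max'_mem hne
          have hn1 : AL.min' hne ≠ y := fun h =>
            Finset.disjoint_left.1 hALBLd hm (h ▸ hy)
          have hn2 : y ≠ AL.max' hne := fun h =>
            Finset.disjoint_left.1 hALBLd hM (h ▸ hy)
          have l1 := lt_of_le_of_ne hyI.1 hn1
          have l2 := lt_of_le_of_ne hyI.2 hn2
          have p1 := pos_add_le L e (hALL hm) l1
          have p2 := pos_add_le L e (hBLL hy) l2
          have q1 := (Finset.mem_filter.1 hm).2
          have q2 := (Finset.mem_filter.1 hM).2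
          have q3 := (Finset.mem_filter.1 hy).2
          have w1 : 0 < 2 ^ e (AL.min' hne) := by positivity
          have w2 : 0 < 2 ^ e (AL.max' hne) := by positivity
          simp only [c, cnt] at q1 q2 q3
          omega
        · intro y hy
          rw [Finset.mem_Icc]
          exact ⟨AL.min'_le y hy, AL.le_max' y hy⟩
    have hBLH : Disjoint BL H := (hHLd.mono_right hBLL).symm
    refine built_step hμ ih hC e e' (A := H ∪ AL) (B := BL) (q := Finset.Icc i k ∪ H)
      ?_ ?_ ?_ ?_ ⟨i, k, H, hHcard, rfl⟩ ?_ ?_ ?_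
    · rw [Finset.union_assoc, hALBL, hHL]
    · rw [Finset.disjoint_union_left]
      exact ⟨hBLH.symm, hALBLd⟩
    · rw [Finset.union_comm]
      exact Finset.union_subset_union hALI subset_rfl
    · rw [Finset.disjoint_union_right]
      exact ⟨Finset.disjoint_left.2 hIcc, hBLH⟩
    · rw [Finset.sum_union (hHLd.mono_right hALL), ← ha]
      refine Nat.add_le_add (le_of_eq ?_) ?_
      · refine Finset.sum_congr rfl fun x hx => ?_
        have : x ∉ L := Finset.disjoint_left.1 hHLd hx
        simp [e', this]
      · refine le_trans (Finset.sum_le_sum fun y hy => ?_) (sum_cnt_le L e hALL θ a)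
        have hy2 := (Finset.mem_filter.1 hy).2
        have hyL := hALL hy
        change 2 ^ e' y ≤ c θ y
        by_cases hcut : cut θ y
        · have := (hcutpos y hcut).1
          simp only [e', hyL, hcut, and_self, if_true]
          omega
        · simp only [e', hcut, and_false, if_false]
          have h0 : 0 < 2 ^ e y := by positivity
          simp only [cut, not_and, not_lt] at hcut
          exact hcut (by omega)
    · refine le_trans (Finset.sum_le_sum fun y hy => ?_)
        (sum_sub_cnt_le L e hBLL θ a (2 ^ j) hθ.le hLsum)
      have hy2 := (Finset.mem_filter.1 hy).2
      have hyL := hBLL hy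
      change 2 ^ e' y ≤ 2 ^ e y - c θ y
      by_cases hcut : cut θ y
      · have := (hcutpos y hcut).1
        simp only [e', hyL, hcut, and_self, if_true]
        omega
      · simp only [e', hcut, and_false, if_false]
        have h0 : 0 < 2 ^ e y := by positivity
        simp only [cut, not_and, not_lt] at hcut
        by_cases hz : 0 < c θ y
        · have := hcut hz; omega
        · omega
    · rw [← hHL, Finset.sum_union hHLd, Finset.sum_union hHLd]
      refine add_le_add ?_ ?_
      · refine Finset.sum_le_sum fun x hx => mul_le_mul_of_nonneg_left ?_ (hμ x)
        have : x ∉ L := Finset.disjoint_left.1 hHLd hx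
        simp only [e', this, false_and, if_false]
        rw [hsucc x (hHC hx)]
        exact G_succ r _
      · have h1 : ∑ y ∈ L, μ y * (1 + G r (j - e' y)) =
            ∑ y ∈ L, μ y * (1 + G r (j - e y)) + ∑ y ∈ L, (if cut θ y then μ y * D y else 0) := by
          rw [← Finset.sum_add_distrib]
          refine Finset.sum_congr rfl fun y hy => ?_
          by_cases hcut : cut θ y
          · have hp := (hcutpos y hcut).2
            have hq := hej y (hLC hy)
            simp only [e', hy, hcut, and_self, if_true]
            rw [show j - (e y - 1) = j - e y + 1 by omega]
            simp only [D]; ring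
          · simp only [e', hcut, and_false, if_false]; ring
        have h2 : ∑ y ∈ L, μ y * G r (j + 1 - e y) =
            ∑ y ∈ L, μ y * (1 + G r (j - e y)) + ∑ y ∈ L, μ y * (D y - 1) := by
          rw [← Finset.sum_add_distrib]
          refine Finset.sum_congr rfl fun y hy => ?_
          rw [hsucc y (hLC hy)]
          simp only [D]; ring
        rw [h1, h2]
        linarith

lemma exists_tree {n : ℕ} {r : ℝ} (hr0 : 0 < r) (hr1 : r < 1) {μ : Fin n → ℝ}
    (hμ : IsDistribution μ) (d : Fin n → ℕ)
    (hd : ∑ x ∈ Finset.univ.filter (fun x => μ x ≠ 0), (1 / 2 : ℝ) ^ d x ≤ 1) :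
    ∃ T : DTree (Fin n), IsValid T μ ∧ UsesQuestions T (QS n r) ∧
      cost T μ ≤ ∑ x, μ x * (d x : ℝ) + 3 * r / 4 := by
  classical
  set C := Finset.univ.filter (fun x => μ x ≠ 0) with hC
  have hCne : C.Nonempty := by
    rw [Finset.nonempty_iff_ne_empty]
    intro h
    have : ∑ x, μ x = 0 := by
      refine Finset.sum_eq_zero fun x _ => ?_
      by_contra hx
      have : x ∈ C := by simp [hC, hx]
      rw [h] at this
      simp at this
    rw [hμ.2] at this
    norm_num at this
  set J := ∑ x, d x with hJ
  have hdJ : ∀ x, d x ≤ J := fun x =>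
    Finset.single_le_sum (f := d) (fun _ _ => Nat.zero_le _) (Finset.mem_univ x)
  have hsum : ∑ x ∈ C, 2 ^ (J - d x) ≤ 2 ^ J := by
    have h1 : ∑ x ∈ C, (2 : ℝ) ^ (J - d x) = 2 ^ J * ∑ x ∈ C, (1 / 2 : ℝ) ^ d x := by
      rw [Finset.mul_sum]
      refine Finset.sum_congr rfl fun x _ => ?_
      have : (2 : ℝ) ^ J = 2 ^ (J - d x) * 2 ^ d x := by
        rw [← pow_add, Nat.sub_add_cancel (hdJ x)]
      rw [this, mul_assoc, ← mul_pow]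
      norm_num
    have h2 : ∑ x ∈ C, (2 : ℝ) ^ (J - d x) ≤ 2 ^ J := by
      rw [h1]
      have : (0 : ℝ) < 2 ^ J := by positivity
      nlinarith
    exact_mod_cast h2
  obtain ⟨T, ⟨g1, g2, g3⟩, h2, h3⟩ := build hr0 hr1 hμ.1 J C hCne (fun x => J - d x) hsum
  refine ⟨T, ⟨g1, ?_, ?_⟩, h2, ?_⟩
  · intro x; rw [g2]; simp [hC]
  · intro x hx; exact g3 x (by simp [hC, hx])
  · have hsupp : ∀ f : Fin n → ℝ, ∑ x, μ x * f x = ∑ x ∈ C, μ x * f x := by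
      intro f
      symm
      apply Finset.sum_subset (Finset.subset_univ _)
      intro x _ hx
      have : μ x = 0 := by
        by_contra h
        exact hx (by simp [hC, h])
      simp [this]
    unfold cost
    rw [hsupp]
    refine h3.trans ?_
    rw [← hsupp (fun x => G r (J - (J - d x)))]
    have h4 : ∑ x, μ x * (d x : ℝ) + 3 * r / 4 = ∑ x, μ x * (d x + 3 * r / 4) := by
      simp only [mul_add, Finset.sum_add_distrib]
      rw [← Finset.sum_mul, hμ.2]; ring
    rw [h4]
    refine Finset.sum_le_sum fun x _ => mul_le_mul_of_nonneg_left ?_ (hμ.1 x)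
    rw [Nat.sub_sub_self (hdJ x)]
    exact G_le r hr0 _

lemma bddBelow_costs {n : ℕ} {μ : Fin n → ℝ} (hμ : IsDistribution μ) :
    BddBelow { c | ∃ T : DTree (Fin n), IsValid T μ ∧ c = cost T μ } := by
  refine ⟨0, ?_⟩
  rintro c ⟨T, _, rfl⟩
  exact Finset.sum_nonneg fun x _ => mul_nonneg (hμ.1 x) (Nat.cast_nonneg _)

lemma optCost_le {n : ℕ} {μ : Fin n → ℝ} (hμ : IsDistribution μ) (d : Fin n → ℕ)
    (hd : ∑ x ∈ Finset.univ.filter (fun x => μ x ≠ 0), (1 / 2 : ℝ) ^ d x ≤ 1) :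
    OptCost μ ≤ ∑ x, μ x * (d x : ℝ) := by
  refine le_of_forall_pos_le_add fun ε hε => ?_
  have h0 : 0 < min ε (1 / 2) := by positivity
  have h1 : min ε (1 / 2) < 1 := lt_of_le_of_lt (min_le_right _ _) (by norm_num)
  obtain ⟨T, hT, _, hc⟩ := exists_tree h0 h1 hμ d hd
  have : OptCost μ ≤ cost T μ := csInf_le (bddBelow_costs hμ) ⟨T, hT, rfl⟩
  have := min_le_left ε (1 / 2)
  linarith

lemma exists_near_opt {n : ℕ} {r : ℝ} (hr0 : 0 < r) (hr1 : r < 1) {μ : Fin n → ℝ}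
    (hμ : IsDistribution μ) :
    ∃ T : DTree (Fin n), IsValid T μ ∧ UsesQuestions T (QS n r) ∧ cost T μ ≤ OptCost μ + r := by
  have hne : { c | ∃ T : DTree (Fin n), IsValid T μ ∧ c = cost T μ }.Nonempty := by
    obtain ⟨T, hT, _⟩ := exists_tree hr0 hr1 hμ (fun _ => n) (by
      rw [Finset.sum_const, nsmul_eq_mul]
      have h1 : ((Finset.univ.filter (fun x => μ x ≠ 0)).card : ℝ) ≤ 2 ^ n := by
        have h2 : (Finset.univ.filter (fun x => μ x ≠ 0)).card ≤ n := by
          simpa using Finset.card_le_univ (Finset.univ.filter (fun x => μ x ≠ 0))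
        have h3 := h2.trans (Nat.lt_two_pow_self (n := n)).le
        exact_mod_cast h3
      rw [one_div, inv_pow, ← div_eq_mul_inv]
      exact div_le_one_of_le₀ h1 (by positivity))
    exact ⟨_, T, hT, rfl⟩
  obtain ⟨c, ⟨T, hT, rfl⟩, hlt⟩ := exists_lt_of_csInf_lt hne
    (show OptCost μ < OptCost μ + r / 4 by linarith)
  obtain ⟨T', h1, h2, h3⟩ := exists_tree hr0 hr1 hμ (fun x => T.depth x)
    (kraft T _ (fun x hx => by
      rw [hT.finds x (Finset.mem_filter.1 hx).2]; rfl))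
  refine ⟨T', h1, h2, ?_⟩
  unfold cost at hlt
  linarith

lemma card_small {n : ℕ} {r : ℝ} (hr0 : 0 < r) (hn : 1 / r < (n : ℝ)) :
    ((Finset.univ.filter (fun S : Finset (Fin n) => (S.card : ℝ) ≤ 16 / r)).card : ℝ)
      ≤ (3 * r * n) ^ ((16 : ℝ) / r) := by
  have hrn : 1 < r * n := by
    rw [div_lt_iff₀ hr0] at hn; linarith
  have hrn0 : 0 < r * n := by linarith
  set s := 16 / r with hs
  have hs0 : 0 < s := by positivity
  set t := (r * n)⁻¹ with ht
  have ht0 : 0 < t := by positivity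
  have h1 : ((Finset.univ.filter (fun S : Finset (Fin n) => (S.card : ℝ) ≤ s)).card : ℝ)
      ≤ ∑ S : Finset (Fin n), (r * n) ^ s * t ^ S.card := by
    rw [Finset.card_eq_sum_ones, Nat.cast_sum]
    refine le_trans (Finset.sum_le_sum fun S hS => ?_)
      (Finset.sum_le_sum_of_subset_of_nonneg (Finset.filter_subset _ _)
        (fun _ _ _ => by positivity))
    have hSs := (Finset.mem_filter.1 hS).2
    rw [ht, inv_pow, ← Real.rpow_natCast, ← div_eq_mul_inv, ← Real.rpow_sub hrn0, Nat.cast_one]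
    exact Real.one_le_rpow hrn.le (by linarith)
  have h2 : ∑ S : Finset (Fin n), t ^ S.card = (1 + t) ^ n := by
    have := Finset.sum_pow_mul_eq_add_pow t 1 (Finset.univ : Finset (Fin n))
    simp only [one_pow, mul_one, Finset.powerset_univ, Finset.card_univ, Fintype.card_fin] at this
    rw [this, add_comm]
  rw [← Finset.mul_sum, h2] at h1
  refine h1.trans ?_
  rw [show 3 * r * (n : ℝ) = (r * n) * 3 by ring, Real.mul_rpow hrn0.le (by norm_num)]
  apply mul_le_mul_of_nonneg_left _ (by positivity)
  have hn0 : (n : ℝ) ≠ 0 := by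
    rintro h; rw [h] at hrn0; simp at hrn0
  calc (1 + t) ^ n ≤ (Real.exp t) ^ n := by
        apply pow_le_pow_left₀ (by positivity)
        linarith [Real.add_one_le_exp t]
    _ = Real.exp (1 / r) := by
        rw [← Real.exp_nat_mul]; congr 1
        rw [ht]; field_simp
    _ ≤ Real.exp s := by
        apply Real.exp_le_exp.2
        rw [hs]; gcongr; norm_num
    _ = (Real.exp 1) ^ s := by rw [Real.exp_one_rpow]
    _ ≤ 3 ^ s := by
        apply Real.rpow_le_rpow (Real.exp_pos _).le _ hs0.le
        linarith [Real.exp_one_lt_d9]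

lemma upper {n : ℕ} {r : ℝ} (hr0 : 0 < r) (hr1 : r < 1) (hn : 1 / r < (n : ℝ)) :
    ∃ Q : Finset (Finset (Fin n)), AchievesProlixity Q r ∧
      (Q.card : ℝ) ≤ (n : ℝ) ^ 2 * (3 * r * n) ^ ((16 : ℝ) / r) := by
  classical
  let F := Finset.univ.filter (fun S : Finset (Fin n) => (S.card : ℝ) ≤ 16 / r)
  let P : Finset ((Fin n × Fin n) × Finset (Fin n)) := Finset.univ ×ˢ F
  refine ⟨P.image (fun p => Finset.Icc p.1.1 p.1.2 ∪ p.2), ?_, ?_⟩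
  · intro μ hμ
    obtain ⟨T, h1, h2, h3⟩ := exists_near_opt hr0 hr1 hμ
    refine ⟨T, h1, ?_, h3⟩
    intro q hq
    obtain ⟨i, k, S, hS, rfl⟩ := h2 hq
    rw [Finset.mem_coe, Finset.mem_image]
    exact ⟨((i, k), S), by simp [P, F, hS], rfl⟩
  · have h1 : (P.image (fun p => Finset.Icc p.1.1 p.1.2 ∪ p.2)).card ≤ n ^ 2 * F.card := by
      refine Finset.card_image_le.trans ?_
      simp [P, Finset.card_product, sq]
    calc _ ≤ ((n ^ 2 * F.card : ℕ) : ℝ) := by exact_mod_cast h1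
      _ = (n : ℝ) ^ 2 * F.card := by push_cast; ring
      _ ≤ _ := mul_le_mul_of_nonneg_left (card_small hr0 hn) (by positivity)

lemma w_a (k d : ℕ) : (1 : ℝ) + k - d ≤ 2 ^ k * (1 / 2) ^ d := by
  rcases le_or_gt d k with h | h
  · obtain ⟨m, rfl⟩ := Nat.exists_eq_add_of_le h
    have h1 : (2 : ℝ) ^ (d + m) * (1 / 2) ^ d = 2 ^ m := by
      rw [pow_add, mul_right_comm, ← mul_pow]; norm_num
    rw [h1]
    have : ((m + 1 : ℕ) : ℝ) ≤ ((2 ^ m : ℕ) : ℝ) := by exact_mod_cast Nat.lt_two_pow_self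
    push_cast at this ⊢
    linarith
  · have : (k : ℝ) + 1 ≤ d := by exact_mod_cast h
    have : (0 : ℝ) < 2 ^ k * (1 / 2) ^ d := by positivity
    linarith

lemma w_c (k d : ℕ) (h : k + 2 ≤ d) : (2 : ℝ) + k - d ≤ 2 ^ k * (1 / 2) ^ d := by
  have : (k : ℝ) + 2 ≤ d := by exact_mod_cast h
  have : (0 : ℝ) < 2 ^ k * (1 / 2) ^ d := by positivity
  linarith

lemma w_b (k d : ℕ) (h : k < d) : (3 / 2 : ℝ) + k - d ≤ 2 ^ k * (1 / 2) ^ d := by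
  rcases Nat.lt_or_ge (k + 1) d with h' | h'
  · have := w_c k d h'
    linarith
  · obtain rfl : d = k + 1 := by omega
    have h1 : (2 : ℝ) ^ k * (1 / 2) ^ (k + 1) = 1 / 2 := by
      rw [pow_succ, ← mul_assoc, ← mul_pow]; norm_num
    rw [h1]; push_cast; linarith

section Lower
variable {α : Type} [DecidableEq α]

lemma side_le (t : DTree α) (P U : Finset α) (x₀ : α) (k : ℕ)
    (hf : ∀ x ∈ P, (t.find? x).isSome)
    (hd : ∀ x ∈ U ∩ P, x ≠ x₀ → t.depth x = k) (hx : x₀ ∈ P → t.depth x₀ = k + 1) :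
    (U ∩ P).card ≤ 2 ^ k := by
  have hK := kraft t (U ∩ P) (fun x hx => hf x (Finset.mem_of_mem_inter_right hx))
  have hp : (0 : ℝ) < (1 / 2) ^ k := by positivity
  have hp2 : (2 : ℝ) ^ k * (1 / 2) ^ k = 1 := by rw [← mul_pow]; norm_num
  have he : ∑ x ∈ (U ∩ P).erase x₀, (1 / 2 : ℝ) ^ t.depth x
      = ((U ∩ P).erase x₀).card * (1 / 2 : ℝ) ^ k := by
    rw [Finset.sum_congr rfl (g := fun _ => (1 / 2 : ℝ) ^ k), Finset.sum_const, nsmul_eq_mul]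
    intro x hx
    rw [hd x (Finset.mem_of_mem_erase hx) (Finset.ne_of_mem_erase hx)]
  by_cases h : x₀ ∈ U ∩ P
  · rw [← Finset.sum_erase_add _ _ h, he, hx (Finset.mem_of_mem_inter_right h)] at hK
    have hc := Finset.card_erase_add_one h
    have h3 : (((U ∩ P).erase x₀).card : ℝ) < 2 ^ k := by
      have : (0 : ℝ) < (1 / 2) ^ (k + 1) := by positivity
      by_contra hh
      push Not at hh
      have := mul_le_mul_of_nonneg_right hh hp.le
      linarith
    have h4 : ((U ∩ P).erase x₀).card < 2 ^ k := by exact_mod_cast h3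
    omega
  · rw [Finset.erase_eq_of_notMem h] at he
    rw [he] at hK
    have h3 : ((U ∩ P).card : ℝ) ≤ 2 ^ k := by
      by_contra hh
      push Not at hh
      have := mul_lt_mul_of_pos_right hh hp
      linarith
    exact_mod_cast h3

lemma side_eq (t : DTree α) (P U : Finset α) (k : ℕ)
    (hf : ∀ x ∈ P, (t.find? x).isSome)
    (hd : ∀ x ∈ U ∩ P, t.depth x = k) (hc : (U ∩ P).card = 2 ^ k) : P ⊆ U := by
  intro y hy
  by_contra hyU
  have hn : y ∉ U ∩ P := fun h => hyU (Finset.mem_of_mem_inter_left h)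
  have hK := kraft t (insert y (U ∩ P)) (fun x hx => by
    rw [Finset.mem_insert] at hx
    rcases hx with rfl | hx
    · exact hf _ hy
    · exact hf x (Finset.mem_of_mem_inter_right hx))
  rw [Finset.sum_insert hn, Finset.sum_congr rfl (g := fun _ => (1 / 2 : ℝ) ^ k), Finset.sum_const,
    nsmul_eq_mul, hc] at hK
  · have hp2 : ((2 ^ k : ℕ) : ℝ) * (1 / 2) ^ k = 1 := by push_cast; rw [← mul_pow]; norm_num
    have : (0 : ℝ) < (1 / 2) ^ t.depth y := by positivity
    linarith
  · intro x hx
    rw [hd x hx]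

lemma depth_rigid (T : DTree α) (U V : Finset α) (k : ℕ) (hUV : U ⊂ V)
    (hf : ∀ x ∈ V, (T.find? x).isSome) (hU : U.card = 2 ^ k)
    (hs : ∑ x ∈ U, T.depth x ≤ k * 2 ^ k + 1) :
    ∃ x₀ ∈ U, T.depth x₀ = k + 1 ∧ ∀ x ∈ U, x ≠ x₀ → T.depth x = k := by
  have hK : ∑ x ∈ U, (1 / 2 : ℝ) ^ T.depth x < 1 := by
    refine lt_of_lt_of_le ?_ (kraft T V hf)
    obtain ⟨y, hyV, hyU⟩ := Finset.exists_of_ssubset hUV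
    exact Finset.sum_lt_sum_of_subset hUV.1 hyV hyU (by positivity) (fun _ _ _ => by positivity)
  have hp : (0 : ℝ) < 2 ^ k := by positivity
  have hUr : (U.card : ℝ) = 2 ^ k := by rw [hU]; push_cast; rfl
  have hsr : ∑ x ∈ U, (T.depth x : ℝ) ≤ k * 2 ^ k + 1 := by exact_mod_cast hs
  set g : α → ℝ := fun x => 2 ^ k * (1 / 2 : ℝ) ^ T.depth x - (1 + k - T.depth x) with hg
  have hg0 : ∀ x ∈ U, 0 ≤ g x := fun x _ => by
    have := w_a k (T.depth x); simp only [hg]; linarith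
  have hgs : ∑ x ∈ U, g x < ∑ x ∈ U, (T.depth x : ℝ) - k * 2 ^ k := by
    simp only [hg, Finset.sum_sub_distrib, Finset.sum_add_distrib, Finset.sum_const, nsmul_eq_mul,
      ← Finset.mul_sum, hUr]
    nlinarith
  have hg1 : ∑ x ∈ U, g x < 1 := by linarith
  have hgpos : 0 ≤ ∑ x ∈ U, g x := Finset.sum_nonneg hg0
  have hgt : k * 2 ^ k < ∑ x ∈ U, T.depth x := by
    have : (k : ℝ) * 2 ^ k < ∑ x ∈ U, (T.depth x : ℝ) := by linarith
    exact_mod_cast this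
  obtain ⟨x₀, hx₀, hlt⟩ : ∃ x₀ ∈ U, k < T.depth x₀ := by
    by_contra hcon
    push Not at hcon
    have := Finset.sum_le_card_nsmul U (fun x => T.depth x) k hcon
    rw [hU, smul_eq_mul, mul_comm] at this
    omega
  have hx₀d : T.depth x₀ = k + 1 := by
    by_contra hne
    have h1 := w_c k (T.depth x₀) (by omega)
    have h2 := Finset.single_le_sum hg0 hx₀
    simp only [hg] at h2
    simp only [hg] at hg1
    linarith
  have hle : ∀ x ∈ U.erase x₀, T.depth x ≤ k := by
    intro x hx
    by_contra hcon
    push Not at hcon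
    have hxU := Finset.mem_of_mem_erase hx
    have hxne := Finset.ne_of_mem_erase hx
    have h1 := w_b k (T.depth x) hcon
    have h2 := w_b k (T.depth x₀) hlt
    have h3 : ∑ z ∈ ({x, x₀} : Finset α), g z ≤ ∑ z ∈ U, g z := by
      apply Finset.sum_le_sum_of_subset_of_nonneg
      · intro z hz
        simp only [Finset.mem_insert, Finset.mem_singleton] at hz
        rcases hz with rfl | rfl <;> assumption
      · intro z hz _; exact hg0 z hz
    rw [Finset.sum_pair hxne] at h3
    have h4 : 1 / 2 ≤ g x := by simp only [hg]; linarith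
    have h5 : 1 / 2 ≤ g x₀ := by simp only [hg]; linarith
    linarith
  refine ⟨x₀, hx₀, hx₀d, ?_⟩
  have hsum := Finset.sum_erase_add U (fun x => T.depth x) hx₀
  simp only [hx₀d] at hsum
  have hcard := Finset.card_erase_add_one hx₀
  have hEq : ∑ x ∈ U.erase x₀, T.depth x = ∑ x ∈ U.erase x₀, k := by
    apply le_antisymm (Finset.sum_le_sum hle)
    rw [Finset.sum_const, smul_eq_mul]
    have : ((U.erase x₀).card + 1) * k = k * 2 ^ k := by rw [hcard, hU, mul_comm]
    rw [add_mul] at this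
    omega
  have := (Finset.sum_eq_sum_iff_of_le hle).1 hEq
  intro x hx hne
  exact this x (Finset.mem_erase.2 ⟨hne, hx⟩)

lemma root_struct [Fintype α] (q : Finset α) (t f : DTree α) (U : Finset α) (k : ℕ)
    (hUV : U ⊂ Finset.univ) (hf : ∀ x, ((DTree.node q t f).find? x).isSome)
    (hU : U.card = 2 ^ (k + 1))
    (hs : ∑ x ∈ U, (DTree.node q t f).depth x ≤ (k + 1) * 2 ^ (k + 1) + 1) :
    (q ⊆ U ∧ q.card = 2 ^ k) ∨ (qᶜ ⊆ U ∧ qᶜ.card = 2 ^ k) := by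
  obtain ⟨x₀, hx₀, h0, h1⟩ := depth_rigid _ U Finset.univ (k + 1) hUV (fun x _ => hf x) hU hs
  have ft : ∀ x ∈ q, (t.find? x).isSome := fun x hx => isSome_node_mem hx (hf x)
  have ff : ∀ x ∈ qᶜ, (f.find? x).isSome := fun x hx =>
    isSome_node_not_mem (Finset.mem_compl.1 hx) (hf x)
  have dt : ∀ x ∈ q, (DTree.node q t f).depth x = t.depth x + 1 := fun x hx =>
    depth_node_mem hx (ft x hx)
  have df : ∀ x ∈ qᶜ, (DTree.node q t f).depth x = f.depth x + 1 := fun x hx =>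
    depth_node_not_mem (Finset.mem_compl.1 hx) (ff x hx)
  have d1 : ∀ x ∈ U ∩ q, x ≠ x₀ → t.depth x = k := by
    intro x hx hne
    rw [Finset.mem_inter] at hx
    have := h1 x hx.1 hne
    rw [dt x hx.2] at this
    omega
  have d2 : ∀ x ∈ U ∩ qᶜ, x ≠ x₀ → f.depth x = k := by
    intro x hx hne
    rw [Finset.mem_inter] at hx
    have := h1 x hx.1 hne
    rw [df x hx.2] at this
    omega
  have c1 := side_le t q U x₀ k ft d1 (fun h => by rw [dt _ h] at h0; omega)
  have c2 := side_le f qᶜ U x₀ k ff d2 (fun h => by rw [df _ h] at h0; omega)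
  have c3 : (U ∩ q).card + (U ∩ qᶜ).card = U.card := by
    rw [← Finset.sdiff_eq_inter_compl, Finset.card_inter_add_card_sdiff]
  rw [hU, pow_succ] at c3
  by_cases hq : x₀ ∈ q
  · right
    have hsub : qᶜ ⊆ U := side_eq f qᶜ U k ff (fun x hx => d2 x hx (fun h => by
      subst h
      exact (Finset.mem_compl.1 (Finset.mem_of_mem_inter_right hx)) hq)) (by omega)
    refine ⟨hsub, ?_⟩
    rw [Finset.inter_eq_right.2 hsub] at c2 c3
    omega
  · left
    have hsub : q ⊆ U := side_eq t q U k ft (fun x hx => d1 x hx (fun h => by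
      subst h
      exact hq (Finset.mem_of_mem_inter_right hx))) (by omega)
    refine ⟨hsub, ?_⟩
    rw [Finset.inter_eq_right.2 hsub] at c1 c3
    omega

end Lower

lemma not_leaf {n : ℕ} (hn : 2 ≤ n) (y : Fin n)
    (h : ∀ x : Fin n, ((DTree.leaf y).find? x).isSome) : False := by
  have : ∀ x : Fin n, y = x := by
    intro x
    have := h x
    simp only [DTree.find?] at this
    split_ifs at this with h
    · exact h
    · simp at this
  have h1 := (this ⟨0, by omega⟩).symm.trans (this ⟨1, by omega⟩)
  simp at h1

lemma exists_question {n : ℕ} {r : ℝ} (hr0 : 0 < r) {Q : Finset (Finset (Fin n))}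
    (hQ : AchievesProlixity Q r) (k : ℕ) (hk : (2 : ℝ) ^ (k + 1) * r < 1) (U : Finset (Fin n))
    (hU : U.card = 2 ^ (k + 1)) (hn : 2 ^ (k + 1) < n) :
    ∃ q ∈ Q, (q ⊆ U ∧ q.card = 2 ^ k) ∨ (qᶜ ⊆ U ∧ qᶜ.card = 2 ^ k) := by
  classical
  set N : ℝ := 2 ^ (k + 1) with hN
  have hN1 : 1 ≤ N := one_le_pow₀ (by norm_num)
  have hN0 : 0 < N := by linarith
  have hUN : (U.card : ℝ) = N := by rw [hU]; push_cast; rfl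
  have hcc : Uᶜ.card = n - 2 ^ (k + 1) := by rw [Finset.card_compl, hU, Fintype.card_fin]
  set M : ℝ := (Uᶜ.card : ℝ) with hM
  have hM1 : 1 ≤ M := by
    have : 1 ≤ Uᶜ.card := by omega
    rw [hM]
    exact_mod_cast this
  have hM0 : 0 < M := by linarith
  set δ : ℝ := 1 / N - r with hδ
  have hδ0 : 0 < δ := by
    have : r < 1 / N := by rw [lt_div_iff₀ hN0]; linarith
    linarith
  have hNi : 1 / N ≤ 1 := by rw [div_le_one hN0]; exact hN1
  have hδ1 : δ < 1 := by linarith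
  set K : ℝ := (k : ℝ) + n + 4 with hK
  have hK0 : 1 < K := by
    have : (0 : ℝ) ≤ k := Nat.cast_nonneg _
    have : (0 : ℝ) ≤ n := Nat.cast_nonneg _
    linarith
  set ε : ℝ := δ / K with hε
  have hε0 : 0 < ε := by positivity
  have hεK : ε * K = δ := by rw [hε]; field_simp
  have hε1 : ε < 1 := by nlinarith
  set μ : Fin n → ℝ := fun x => if x ∈ U then (1 - ε) / N else ε / M with hμdef
  have hsum : ∀ g : Fin n → ℝ, ∑ x, μ x * g x =
      (1 - ε) / N * ∑ x ∈ U, g x + ε / M * ∑ x ∈ Uᶜ, g x := by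
    intro g
    rw [← Finset.sum_add_sum_compl U, Finset.mul_sum, Finset.mul_sum]
    congr 1
    · refine Finset.sum_congr rfl fun x hx => ?_
      simp only [hμdef, hx, if_true]
    · refine Finset.sum_congr rfl fun x hx => ?_
      simp only [hμdef, Finset.mem_compl.1 hx, if_false]
  have hμpos : ∀ x, 0 < μ x := by
    intro x
    simp only [hμdef]
    split_ifs
    · exact div_pos (by linarith) hN0
    · positivity
  have hμ : IsDistribution μ := by
    refine ⟨fun x => (hμpos x).le, ?_⟩
    have := hsum (fun _ => 1)
    simp only [mul_one, Finset.sum_const, nsmul_eq_mul, hUN] at this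
    rw [this, ← hM]
    field_simp
    ring
  obtain ⟨x₀, hx₀⟩ : U.Nonempty := by
    rw [← Finset.card_pos, hU]; positivity
  have hUcard := Finset.card_erase_add_one hx₀
  have hUe : ((U.erase x₀).card : ℝ) = N - 1 := by
    rw [hU] at hUcard
    have : ((U.erase x₀).card : ℝ) + 1 = N := by rw [hN]; exact_mod_cast hUcard
    linarith
  set d : Fin n → ℕ := fun x => if x ∈ U then (if x = x₀ then k + 2 else k + 1) else k + 2 + n
    with hd
  have dU : ∀ x ∈ U.erase x₀, d x = k + 1 := fun x hx => by
    simp [hd, Finset.mem_of_mem_erase hx, Finset.ne_of_mem_erase hx]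
  have d0 : d x₀ = k + 2 := by simp [hd, hx₀]
  have dC : ∀ x ∈ Uᶜ, d x = k + 2 + n := fun x hx => by
    simp only [hd, Finset.mem_compl.1 hx, if_false]
  have hMn : M ≤ 2 ^ n := by
    have : Uᶜ.card ≤ 2 ^ n := by
      have := (Nat.lt_two_pow_self (n := n)).le
      omega
    rw [hM]; exact_mod_cast this
  have hkr : ∑ x ∈ Finset.univ.filter (fun x => μ x ≠ 0), (1 / 2 : ℝ) ^ d x ≤ 1 := by
    rw [Finset.filter_true_of_mem (fun x _ => (hμpos x).ne'), ← Finset.sum_add_sum_compl U,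
      ← Finset.sum_erase_add _ _ hx₀, d0,
      Finset.sum_congr rfl (fun x hx => by rw [dU x hx]),
      Finset.sum_congr (s₁ := Uᶜ) rfl (fun x hx => by rw [dC x hx]),
      Finset.sum_const, Finset.sum_const, nsmul_eq_mul, nsmul_eq_mul, hUe, ← hM]
    have e1 : (1 / 2 : ℝ) ^ (k + 1) = 1 / N := by rw [hN, one_div_pow]
    have e2 : (1 / 2 : ℝ) ^ (k + 2) = 1 / N / 2 := by rw [pow_succ, e1]; ring
    rw [pow_add _ (k + 2) n, e2, e1, one_div_pow]
    have e3 : M * (1 / 2 ^ n) ≤ 1 := by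
      rw [mul_one_div]; exact div_le_one_of_le₀ hMn (by positivity)
    have e4 : 0 < 1 / N := by positivity
    have e5 : N * (1 / N) = 1 := by field_simp
    nlinarith
  have hopt := optCost_le hμ d hkr
  have hdU : ∑ x ∈ U, (d x : ℝ) = (k + 1) * N + 1 := by
    rw [← Finset.sum_erase_add _ _ hx₀, d0,
      Finset.sum_congr rfl (fun x hx => by rw [dU x hx]), Finset.sum_const, nsmul_eq_mul, hUe]
    push_cast; ring
  have hdC : ∑ x ∈ Uᶜ, (d x : ℝ) = M * (k + 2 + n) := by
    rw [Finset.sum_congr rfl (fun x hx => by rw [dC x hx]), Finset.sum_const, nsmul_eq_mul, ← hM]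
    push_cast; ring
  rw [hsum, hdU, hdC] at hopt
  obtain ⟨T, hT, hTQ, hcost⟩ := hQ μ hμ
  have hfind : ∀ x, (T.find? x).isSome := fun x => by rw [hT.finds x (hμpos x).ne']; rfl
  have hs : ∑ x ∈ U, T.depth x ≤ (k + 1) * 2 ^ (k + 1) + 1 := by
    by_contra hcon
    push Not at hcon
    have h1 : ((k : ℝ) + 1) * N + 2 ≤ ∑ x ∈ U, (T.depth x : ℝ) := by
      have : (k + 1) * 2 ^ (k + 1) + 2 ≤ ∑ x ∈ U, T.depth x := hcon
      rw [hN]; exact_mod_cast this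
    unfold cost at hcost
    rw [hsum] at hcost
    have h2 : 0 ≤ ε / M * ∑ x ∈ Uᶜ, (T.depth x : ℝ) := by positivity
    have h3 : (1 - ε) / N * (((k : ℝ) + 1) * N + 2) ≤ (1 - ε) / N * ∑ x ∈ U, (T.depth x : ℝ) :=
      mul_le_mul_of_nonneg_left h1 (div_nonneg (by linarith) hN0.le)
    have h4 : ε / M * (M * ((k : ℝ) + 2 + n)) = ε * (k + 2 + n) := by field_simp
    have h5 : (1 - ε) / N * (((k : ℝ) + 1) * N + 2) - (1 - ε) / N * (((k : ℝ) + 1) * N + 1)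
        = (1 - ε) * (1 / N) := by ring
    have h6 : (1 - ε) * (1 / N) ≤ ε * (k + 2 + n) + r := by linarith
    have h7 : ε * (1 / N) ≤ ε * 1 := mul_le_mul_of_nonneg_left hNi hε0.le
    nlinarith
  have h2 : 2 ≤ n := by
    have : 1 ≤ 2 ^ (k + 1) := Nat.one_le_two_pow
    omega
  have hUV : U ⊂ Finset.univ := by
    rw [Finset.ssubset_univ_iff]
    rintro rfl
    rw [Finset.card_univ, Fintype.card_fin] at hU
    omega
  cases T with
  | leaf y => exact (not_leaf h2 y hfind).elim
  | node q t f =>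
    refine ⟨q, hTQ (by simp [DTree.questions]), ?_⟩
    exact root_struct q t f U k hUV hfind hU hs

lemma desc_ineq (a n : ℕ) (h : a ≤ n) (k : ℕ) :
    a.descFactorial k * n ^ k ≤ n.descFactorial k * a ^ k := by
  induction k with
  | zero => simp
  | succ k ih =>
    rw [Nat.descFactorial_succ, Nat.descFactorial_succ]
    have h1 : (a - k) * n ≤ (n - k) * a := by
      rw [Nat.sub_mul, Nat.sub_mul, mul_comm n a]
      exact Nat.sub_le_sub_left (Nat.mul_le_mul_left k h) _
    calc (a - k) * a.descFactorial k * n ^ (k + 1)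
        = ((a - k) * n) * (a.descFactorial k * n ^ k) := by ring
      _ ≤ ((n - k) * a) * (n.descFactorial k * a ^ k) := Nat.mul_le_mul h1 ih
      _ = _ := by ring

lemma choose_ineq (a n : ℕ) (h : a ≤ n) (k : ℕ) :
    a.choose k * n ^ k ≤ n.choose k * a ^ k := by
  have := desc_ineq a n h k
  rw [Nat.descFactorial_eq_factorial_mul_choose, Nat.descFactorial_eq_factorial_mul_choose,
    mul_assoc, mul_assoc] at this
  exact Nat.le_of_mul_le_mul_left this (Nat.factorial_pos k)

lemma card_supersets {n m : ℕ} (p : Finset (Fin n)) (hp : p.card = m) :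
    ((Finset.powersetCard (2 * m) (Finset.univ : Finset (Fin n))).filter (fun U => p ⊆ U)).card
      ≤ (n - m).choose m := by
  have h1 : (Finset.powersetCard m pᶜ).card = (n - m).choose m := by
    rw [Finset.card_powersetCard, Finset.card_compl, hp, Fintype.card_fin]
  rw [← h1]
  apply Finset.card_le_card_of_injOn (fun U => U \ p)
  · intro U hU
    simp only [Finset.coe_filter, Finset.mem_powersetCard, Set.mem_ofPred_eq] at hU
    rw [Finset.mem_coe, Finset.mem_powersetCard]
    refine ⟨?_, ?_⟩
    · intro x hx
      exact Finset.mem_compl.2 (Finset.mem_sdiff.1 hx).2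
    · rw [Finset.card_sdiff_of_subset hU.2, hU.1.2, hp]; omega
  · intro U hU V hV hUV
    simp only [Finset.coe_filter, Finset.mem_powersetCard, Set.mem_ofPred_eq] at hU hV
    simp only at hUV
    rw [← Finset.sdiff_union_of_subset hU.2, hUV, Finset.sdiff_union_of_subset hV.2]

lemma count_bound {n m : ℕ} (hmn : 2 * m ≤ n) (Q : Finset (Finset (Fin n)))
    (h : ∀ U : Finset (Fin n), U.card = 2 * m →
      ∃ q ∈ Q, (q ⊆ U ∧ q.card = m) ∨ (qᶜ ⊆ U ∧ qᶜ.card = m)) :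
    n.choose m ≤ 2 * Q.card * (2 * m).choose m := by
  classical
  set Q' := (Q ∪ Q.image (fun q => qᶜ)).filter (fun p => p.card = m) with hQ'
  have hQ'c : Q'.card ≤ 2 * Q.card := by
    refine (Finset.card_filter_le _ _).trans ((Finset.card_union_le _ _).trans ?_)
    have : (Q.image (fun q => qᶜ)).card ≤ Q.card := Finset.card_image_le
    omega
  have hsub : Finset.powersetCard (2 * m) (Finset.univ : Finset (Fin n)) ⊆
      Q'.biUnion (fun p => (Finset.powersetCard (2 * m) Finset.univ).filter (fun U => p ⊆ U)) := by
    intro U hU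
    rw [Finset.mem_biUnion]
    obtain ⟨q, hq, h1 | h1⟩ := h U (Finset.mem_powersetCard.1 hU).2
    · exact ⟨q, by simp [hQ', hq, h1.2], Finset.mem_filter.2 ⟨hU, h1.1⟩⟩
    · refine ⟨qᶜ, ?_, Finset.mem_filter.2 ⟨hU, h1.1⟩⟩
      rw [hQ', Finset.mem_filter]
      exact ⟨Finset.mem_union_right _ (Finset.mem_image_of_mem _ hq), h1.2⟩
  have h1 : n.choose (2 * m) ≤ 2 * Q.card * (n - m).choose m := by
    have e1 := Finset.card_le_card hsub
    rw [Finset.card_powersetCard, Finset.card_univ, Fintype.card_fin] at e1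
    have e2 := Finset.card_biUnion_le_card_mul Q'
      (fun p => (Finset.powersetCard (2 * m) Finset.univ).filter (fun U => p ⊆ U))
      ((n - m).choose m) (fun p hp => card_supersets p (Finset.mem_filter.1 hp).2)
    exact e1.trans (e2.trans (Nat.mul_le_mul_right _ hQ'c))
  have h2 : n.choose (2 * m) * (2 * m).choose m = n.choose m * (n - m).choose m := by
    have := Nat.choose_mul (n := n) (k := 2 * m) (s := m) (by omega)
    rw [this]
    congr 2
    omega
  have h3 : 0 < (n - m).choose m := Nat.choose_pos (by omega)
  have h4 : n.choose m * (n - m).choose m ≤ (2 * Q.card * (2 * m).choose m) * (n - m).choose m := by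
    rw [← h2]
    calc _ ≤ 2 * Q.card * (n - m).choose m * (2 * m).choose m := Nat.mul_le_mul_right _ h1
      _ = _ := by ring
  exact Nat.le_of_mul_le_mul_right h4 h3

lemma lower {n : ℕ} {r : ℝ} (hr0 : 0 < r) (hr1 : r < 1) (hn : 1 / r < (n : ℝ))
    {Q : Finset (Finset (Fin n))} (hQ : AchievesProlixity Q r) :
    (1 / (n : ℝ)) * (r * n) ^ ((1 : ℝ) / (4 * r)) ≤ (Q.card : ℝ) := by
  have hrn : 1 < r * n := by
    rw [div_lt_iff₀ hr0] at hn; linarith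
  have hn1 : (1 : ℝ) < n := by
    have : 1 < 1 / r := by rw [lt_div_iff₀ hr0]; linarith
    linarith
  have hn2 : 2 ≤ n := by
    have : 1 < n := by exact_mod_cast hn1
    omega
  have hn2r : (2 : ℝ) ≤ n := by exact_mod_cast hn2
  rcases lt_or_ge r (1 / 2) with hr | hr
  · obtain ⟨k, hk1, hk2⟩ : ∃ k : ℕ, 1 / (4 * r) ≤ 2 ^ k ∧ (2 : ℝ) ^ (k + 1) * r < 1 := by
      have hex : ∃ k : ℕ, 1 / (4 * r) ≤ (2 : ℝ) ^ k := by
        obtain ⟨k, hk⟩ := pow_unbounded_of_one_lt (1 / (4 * r)) (by norm_num : (1 : ℝ) < 2)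
        exact ⟨k, hk.le⟩
      classical
      refine ⟨Nat.find hex, Nat.find_spec hex, ?_⟩
      rcases hfi : Nat.find hex with _ | k
      · norm_num; linarith
      · have := Nat.find_min hex (m := k) (by omega)
        push Not at this
        rw [lt_div_iff₀ (by positivity)] at this
        rw [pow_succ, pow_succ]; linarith
    have hlt : 2 ^ (k + 1) < n := by
      have : (2 : ℝ) ^ (k + 1) < n := by
        have : (2 : ℝ) ^ (k + 1) < 1 / r := by rw [lt_div_iff₀ hr0]; exact hk2
        linarith
      exact_mod_cast this
    have h2m : 2 ^ (k + 1) = 2 * 2 ^ k := pow_succ' 2 k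
    have hcb := count_bound (m := 2 ^ k) (by omega) Q (fun U hU =>
      exists_question hr0 hQ k hk2 U (by rw [hU, h2m]) hlt)
    set m := 2 ^ k with hm
    have hmr : (m : ℝ) = 2 ^ k := by rw [hm]; push_cast; rfl
    have hm0 : (0 : ℝ) < m := by rw [hmr]; positivity
    have hch := choose_ineq (2 * m) n (by omega) m
    have h1 : (2 * m).choose m * n ^ m ≤ (2 * m).choose m * (2 * Q.card * (2 * m) ^ m) := by
      calc _ ≤ _ := hch
        _ ≤ (2 * Q.card * (2 * m).choose m) * (2 * m) ^ m := Nat.mul_le_mul_right _ hcb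
        _ = _ := by ring
    have h2 := Nat.le_of_mul_le_mul_left h1 (Nat.choose_pos (by omega))
    have h3 : (n : ℝ) ^ m ≤ 2 * Q.card * (2 * m) ^ m := by exact_mod_cast h2
    have h4 : (r * n) ^ ((1 : ℝ) / (4 * r)) ≤ 2 * Q.card := by
      calc (r * n) ^ ((1 : ℝ) / (4 * r)) ≤ (r * n) ^ (m : ℝ) :=
            Real.rpow_le_rpow_of_exponent_le hrn.le (by rw [hmr]; exact hk1)
        _ = (r * n) ^ m := Real.rpow_natCast _ _
        _ ≤ (n / (2 * m)) ^ m := by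
            apply pow_le_pow_left₀ (by linarith)
            rw [le_div_iff₀ (by positivity)]
            rw [pow_succ, ← hmr] at hk2
            nlinarith
        _ = n ^ m / (2 * m) ^ m := div_pow _ _ _
        _ ≤ 2 * Q.card := by
            rw [div_le_iff₀ (by positivity)]
            exact h3
    rw [one_div_mul_eq_div, div_le_iff₀ (by linarith)]
    have : (0 : ℝ) ≤ Q.card := Nat.cast_nonneg _
    nlinarith
  · have hne : 1 ≤ Q.card := by
      by_contra hcon
      have hQ0 : Q = ∅ := by
        rw [← Finset.card_eq_zero]; omega
      have hpos : ∀ x : Fin n, (1 / n : ℝ) ≠ 0 := fun _ => by positivity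
      obtain ⟨T, hT, hTQ, _⟩ := hQ (fun _ => 1 / n) ⟨fun _ => by positivity, by
        rw [Finset.sum_const, Finset.card_univ, Fintype.card_fin, nsmul_eq_mul]
        field_simp⟩
      have hfind : ∀ x, (T.find? x).isSome := fun x => by rw [hT.finds x (hpos x)]; rfl
      cases T with
      | leaf y => exact not_leaf hn2 y hfind
      | node q t f =>
        have : q ∈ (Q : Set (Finset (Fin n))) := hTQ (by simp [DTree.questions])
        rw [hQ0] at this
        simp at this
    have hne' : (1 : ℝ) ≤ Q.card := by exact_mod_cast hne
    refine le_trans ?_ hne'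
    rw [one_div_mul_eq_div, div_le_one (by linarith)]
    calc (r * n) ^ ((1 : ℝ) / (4 * r)) ≤ (r * n) ^ (1 : ℝ) := by
          apply Real.rpow_le_rpow_of_exponent_le hrn.le
          rw [div_le_one (by positivity)]; linarith
      _ = r * n := Real.rpow_one _
      _ ≤ n := by nlinarith

end TQ

open TQ in
/-- For `r ∈ (0,1)` and `n > 1/r`:
`(1/n)·(rn)^{1/(4r)} ≤ u_Opt(n,r) ≤ n²·(3rn)^{16/r}`. -/
theorem uOpt_prolixity_bounds (r : ℝ) (hr0 : 0 < r) (hr1 : r < 1)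
    (n : ℕ) (hn : 1 / r < (n : ℝ)) :
    (1 / (n : ℝ)) * (r * n) ^ ((1 : ℝ) / (4 * r)) ≤ (uOpt n r : ℝ) ∧
    (uOpt n r : ℝ) ≤ (n : ℝ) ^ 2 * (3 * r * n) ^ ((16 : ℝ) / r) := by
  obtain ⟨Q₀, hQ₀, hcard⟩ := upper hr0 hr1 hn
  have hne : { k | ∃ Q : Finset (Finset (Fin n)), Q.card = k ∧ AchievesProlixity Q r }.Nonempty :=
    ⟨Q₀.card, Q₀, rfl, hQ₀⟩
  constructor
  · obtain ⟨Q, hQc, hQ⟩ := Nat.sInf_mem hne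
    have h := lower hr0 hr1 hn hQ
    rw [hQc] at h
    exact h
  · have h : uOpt n r ≤ Q₀.card := Nat.sInf_le ⟨Q₀, rfl, hQ₀⟩
    exact le_trans (by exact_mod_cast h) hcard
end

section
/- Every fibre in X_n is a dyadic hitter: if F is a collection of subsets of X_n that intersects every maximal antichain in the poset of subsets of X_n ordered by inclusion, then for every non-constant dyadic distribution μ on X_n there exists A ∈ F with μ(A) = 1/2. -/
/-- `μ` is a probability distribution. -/
def IsDistribution {α : Type} [Fintype α] (μ : α → ℝ) : Prop :=
  (∀ x, 0 ≤ μ x) ∧ ∑ x, μ x = 1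

/-- `μ` is dyadic: every probability is `0` or an integer power of `1/2`. -/
def IsDyadic {α : Type} (μ : α → ℝ) : Prop :=
  ∀ x, μ x = 0 ∨ ∃ d : ℤ, μ x = (1 / 2 : ℝ) ^ d

/-- `μ` is non-constant: its support has at least two elements. -/
def NonConstant {α : Type} (μ : α → ℝ) : Prop :=
  ∃ x y, x ≠ y ∧ μ x ≠ 0 ∧ μ y ≠ 0

lemma pow_half_mult (d e : ℤ) (h : (1 / 2 : ℝ) ^ d ≤ (1 / 2 : ℝ) ^ e) :
    ∃ k : ℤ, (1 / 2 : ℝ) ^ e = k * (1 / 2 : ℝ) ^ d := by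
  have hed : e ≤ d := (zpow_le_zpow_iff_right_of_lt_one₀ (by norm_num) (by norm_num)).1 h
  obtain ⟨m, hm⟩ := Int.eq_ofNat_of_zero_le (sub_nonneg.2 hed)
  refine ⟨2 ^ m, ?_⟩
  have : d = e + (m : ℤ) := by omega
  rw [this, zpow_add₀ (by norm_num), zpow_natCast]
  push_cast
  rw [mul_comm, mul_assoc, ← mul_pow]
  norm_num

lemma sum_mult {n : ℕ} (μ : Fin n → ℝ) (hd : IsDyadic μ) (x : Fin n) (hx : μ x ≠ 0)
    (S : Finset (Fin n)) (hS : ∀ y ∈ S, μ y ≠ 0 → μ x ≤ μ y) :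
    ∃ k : ℤ, ∑ y ∈ S, μ y = k * μ x := by
  have h : ∀ y, ∃ k : ℤ, y ∈ S → μ y = k * μ x := by
    intro y
    by_cases hy : y ∈ S
    · rcases hd y with h0 | ⟨e, he⟩
      · exact ⟨0, by simp [h0]⟩
      · rcases hd x with h0 | ⟨d, hd'⟩
        · exact absurd h0 hx
        · have := hS y hy (by rw [he]; positivity)
          rw [hd', he] at this
          obtain ⟨k, hk⟩ := pow_half_mult d e this
          exact ⟨k, fun _ => by rw [hd', he, hk]⟩
    · exact ⟨0, fun h => absurd h hy⟩
  choose k hk using h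
  refine ⟨∑ y ∈ S, k y, ?_⟩
  push_cast
  rw [Finset.sum_mul]
  exact Finset.sum_congr rfl fun y hy => hk y hy

lemma le_half {n : ℕ} (μ : Fin n → ℝ) (hμ : IsDistribution μ) (hd : IsDyadic μ)
    (hnc : NonConstant μ) (x : Fin n) : μ x ≤ 1 / 2 := by
  obtain ⟨hpos, hsum⟩ := hμ
  have : ∃ y, y ≠ x ∧ μ y ≠ 0 := by
    obtain ⟨a, b, hab, ha, hb⟩ := hnc
    by_cases h : a = x
    · exact ⟨b, fun h' => hab (h.trans h'.symm), hb⟩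
    · exact ⟨a, h, ha⟩
  obtain ⟨y, hyx, hy⟩ := this
  have hy' : 0 < μ y := lt_of_le_of_ne (hpos y) hy.symm
  have h2 : ∑ z ∈ ({y, x} : Finset (Fin n)), μ z ≤ ∑ z, μ z :=
    Finset.sum_le_sum_of_subset_of_nonneg (Finset.subset_univ _) fun z _ _ => hpos z
  rw [Finset.sum_pair hyx, hsum] at h2
  rcases hd x with h0 | ⟨d, hd'⟩
  · rw [h0]; norm_num
  · have hlt : (1 / 2 : ℝ) ^ d < (1 / 2 : ℝ) ^ (0 : ℤ) := by rw [← hd', zpow_zero]; linarith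
    have h1 : 0 < d := (zpow_lt_zpow_iff_right_of_lt_one₀ (by norm_num) (by norm_num)).1 hlt
    have : (1 / 2 : ℝ) ^ d ≤ (1 / 2 : ℝ) ^ (1 : ℤ) :=
      (zpow_le_zpow_iff_right_of_lt_one₀ (by norm_num) (by norm_num)).2 (by omega)
    rw [hd']; simpa using this

lemma half_mult {n : ℕ} (μ : Fin n → ℝ) (hμ : IsDistribution μ) (hd : IsDyadic μ)
    (hnc : NonConstant μ) (x : Fin n) (hx : μ x ≠ 0) : ∃ k : ℤ, (1 / 2 : ℝ) = k * μ x := by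
  have h := le_half μ hμ hd hnc x
  rcases hd x with h0 | ⟨d, hd'⟩
  · exact absurd h0 hx
  · obtain ⟨k, hk⟩ := pow_half_mult d 1 (by rw [← hd']; simpa using h)
    exact ⟨k, by rw [hd', ← hk]; simp⟩

lemma gap {m a : ℝ} (hm : 0 < m) (k l : ℤ) (hk : (1 / 2 : ℝ) = k * m) (hl : a = l * m)
    (h : a < 1 / 2) : a + m ≤ 1 / 2 := by
  rw [hk, hl] at h
  have h1 : (l : ℝ) < k := lt_of_mul_lt_mul_right h hm.le
  have h2 : l + 1 ≤ k := by exact_mod_cast h1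
  have h3 : (l : ℝ) + 1 ≤ k := by exact_mod_cast h2
  rw [hk, hl]
  nlinarith

lemma extend {n : ℕ} (μ : Fin n → ℝ) (hμ : IsDistribution μ) (hd : IsDyadic μ)
    (hnc : NonConstant μ) (R : Finset (Fin n)) (hR : ∑ x ∈ R, μ x ≤ 1 / 2) :
    ∃ S, R ⊆ S ∧ ∑ x ∈ S, μ x = 1 / 2 := by
  classical
  have hne : (Finset.univ.filter fun S : Finset (Fin n) =>
      R ⊆ S ∧ ∑ x ∈ S, μ x ≤ 1 / 2).Nonempty := ⟨R, by simpa using hR⟩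
  obtain ⟨S, hS, hmax⟩ := Finset.exists_max_image _ Finset.card hne
  simp only [Finset.mem_filter, Finset.mem_univ, true_and] at hS hmax
  refine ⟨S, hS.1, ?_⟩
  by_contra hcon
  have hlt := lt_of_le_of_ne hS.2 hcon
  have hcomp : ∑ x ∈ S, μ x + ∑ x ∈ Sᶜ, μ x = 1 := by
    rw [Finset.sum_add_sum_compl, hμ.2]
  have hne2 : (Sᶜ.filter fun x => μ x ≠ 0).Nonempty := by
    by_contra h
    rw [Finset.not_nonempty_iff_eq_empty, Finset.filter_eq_empty_iff] at h
    have : ∑ x ∈ Sᶜ, μ x = 0 := Finset.sum_eq_zero fun x hx => not_not.1 (h hx)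
    linarith
  obtain ⟨x, hx, hmin⟩ := Finset.exists_min_image _ μ hne2
  simp only [Finset.mem_filter, Finset.mem_compl] at hx hmin
  have hxp : 0 < μ x := lt_of_le_of_ne (hμ.1 x) hx.2.symm
  obtain ⟨k, hk⟩ := half_mult μ hμ hd hnc x hx.2
  obtain ⟨l, hl⟩ := sum_mult μ hd x hx.2 Sᶜ fun y hy h0 =>
    hmin y ⟨Finset.mem_compl.1 hy, h0⟩
  have hg := gap hxp k (2 * k - l) hk (a := ∑ x ∈ S, μ x) (by push_cast; linarith) hlt
  have := hmax (insert x S) ⟨hS.1.trans (Finset.subset_insert _ _), by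
    rw [Finset.sum_insert hx.1]; linarith⟩
  rw [Finset.card_insert_of_notMem hx.1] at this
  omega

/-- Every fibre (a collection of subsets of `X_n` meeting every maximal antichain of
the inclusion order) is a dyadic hitter: for every non-constant dyadic distribution
`μ` there is `A` in the fibre with `μ(A) = 1/2`. -/
theorem fibre_is_dyadic_hitter (n : ℕ) (F : Set (Finset (Fin n)))
    (hF : ∀ A : Set (Finset (Fin n)), IsAntichain (· ⊆ ·) A →
      (∀ B : Set (Finset (Fin n)), A ⊆ B → IsAntichain (· ⊆ ·) B → B = A) →
      (F ∩ A).Nonempty)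
    (μ : Fin n → ℝ) (hμ : IsDistribution μ) (hd : IsDyadic μ) (hnc : NonConstant μ) :
    ∃ A ∈ F, ∑ x ∈ A, μ x = 1 / 2 := by
  classical
  have hsupp : (Finset.univ.filter fun x => μ x ≠ 0).Nonempty := by
    obtain ⟨a, b, hab, ha, hb⟩ := hnc
    exact ⟨a, by simpa using ha⟩
  obtain ⟨x0, hx0, hmin⟩ := Finset.exists_min_image _ μ hsupp
  simp only [Finset.mem_filter, Finset.mem_univ, true_and] at hx0 hmin
  have hx0p : 0 < μ x0 := lt_of_le_of_ne (hμ.1 x0) hx0.symm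
  have hcompl : ∀ S : Finset (Fin n), ∑ x ∈ S, μ x + ∑ x ∈ Sᶜ, μ x = 1 := fun S => by
    rw [Finset.sum_add_sum_compl, hμ.2]
  -- small sets extend
  have small : ∀ T : Finset (Fin n), ∑ x ∈ T, μ x < 1 / 2 →
      ∃ S, T ⊆ S ∧ ∑ x ∈ S, μ x = 1 / 2 ∧ x0 ∈ S ∧ ∀ x, μ x = 0 → x ∈ S := by
    intro T hT
    obtain ⟨k, hk⟩ := half_mult μ hμ hd hnc x0 hx0
    obtain ⟨l, hl⟩ := sum_mult μ hd x0 hx0 T fun y _ h0 => hmin y h0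
    have hg := gap hx0p k l hk hl hT
    have h1 : ∑ x ∈ insert x0 T, μ x ≤ 1 / 2 := by
      by_cases h : x0 ∈ T
      · rw [Finset.insert_eq_of_mem h]; exact hT.le
      · rw [Finset.sum_insert h]; linarith
    have h2 : ∑ x ∈ insert x0 T ∪ Finset.univ.filter (fun x => μ x = 0), μ x
        = ∑ x ∈ insert x0 T, μ x := by
      symm
      apply Finset.sum_subset Finset.subset_union_left
      intro x hx hx'
      rcases Finset.mem_union.1 hx with h | h
      · exact absurd h hx'
      · simpa using h
    obtain ⟨S, hS, hS'⟩ := extend μ hμ hd hnc _ (h2.trans_le h1)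
    refine ⟨S, fun x hx => hS ?_, hS', hS ?_, fun x hx => hS ?_⟩ <;> simp_all
  have half_eq : ∀ S T : Finset (Fin n), S ⊆ T → ∑ x ∈ S, μ x = 1 / 2 →
      ∑ x ∈ T, μ x = 1 / 2 → ∀ x ∈ T, x ∉ S → μ x = 0 := by
    intro S T hST hS hT x hxT hxS
    have h := Finset.sum_sdiff (f := μ) hST
    have h0 : ∑ x ∈ T \ S, μ x = 0 := by linarith
    exact (Finset.sum_eq_zero_iff_of_nonneg fun y _ => hμ.1 y).1 h0 x
      (Finset.mem_sdiff.2 ⟨hxT, hxS⟩)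
  let A : Set (Finset (Fin n)) :=
    {S | ∑ x ∈ S, μ x = 1 / 2 ∧ ∀ x, μ x = 0 → (x ∈ S ↔ x0 ∈ S)}
  have hA : IsAntichain (· ⊆ ·) A := by
    intro S hS T hT hne hST
    have key := half_eq S T hST hS.1 hT.1
    apply hne
    apply Finset.Subset.antisymm hST
    intro x hxT
    by_contra hxS
    have hx := key x hxT hxS
    have h1 := (hT.2 x hx).1 hxT
    have h2 : x0 ∉ S := fun h => hxS ((hS.2 x hx).2 h)
    exact hx0 (key x0 h1 h2)
  have comp : ∀ T : Finset (Fin n), ∃ S ∈ A, S ⊆ T ∨ T ⊆ S := by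
    intro T
    rcases lt_trichotomy (∑ x ∈ T, μ x) (1 / 2) with h | h | h
    · obtain ⟨S, h1, h2, h3, h4⟩ := small T h
      exact ⟨S, ⟨h2, fun x hx => by simp [h3, h4 x hx]⟩, Or.inr h1⟩
    · by_cases hT : x0 ∈ T
      · refine ⟨T ∪ Finset.univ.filter (fun x => μ x = 0), ⟨?_, ?_⟩,
          Or.inr Finset.subset_union_left⟩
        · rw [← h]
          symm
          apply Finset.sum_subset Finset.subset_union_left
          intro x hx hx'
          rcases Finset.mem_union.1 hx with h | h
          · exact absurd h hx'
          · simpa using h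
        · intro x hx
          simp [hx, hT]
      · refine ⟨T.filter (fun x => μ x ≠ 0), ⟨?_, ?_⟩, Or.inl (Finset.filter_subset _ _)⟩
        · rw [Finset.sum_filter_ne_zero, h]
        · intro x hx
          simp [hx, hT]
    · obtain ⟨S, h1, h2, h3, h4⟩ := small Tᶜ (by linarith [hcompl T])
      refine ⟨Sᶜ, ⟨by linarith [hcompl S], fun x hx => by simp [h3, h4 x hx]⟩, Or.inl ?_⟩
      intro x hx
      by_contra hxT
      exact (Finset.mem_compl.1 hx) (h1 (Finset.mem_compl.2 hxT))
  obtain ⟨S, hSF, hSA⟩ := hF A hA (by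
    intro B hAB hB
    apply Set.Subset.antisymm _ hAB
    intro T hT
    obtain ⟨S, hS, h⟩ := comp T
    rcases h with h | h
    · rw [← hB.eq (hAB hS) hT h]; exact hS
    · rw [hB.eq hT (hAB hS) h]; exact hS)
  exact ⟨S, hSF, hSA.1⟩
end
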